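/- Let C : ℕ × ℕ → ℤ be any function satisfying: (i) C(n,0) = 0 and C(n,n) = 1 for every n ≥ 1, and (ii) the Pascal-type recursion C(n,l) = C(n−1, l−1) + C(n, l+1) for every n ≥ 2 and every l with 1 ≤ l ≤ n−1. Then for every n ≥ 1 and every l with 0 ≤ l ≤ n one has the closed formula C(n,l) = C(2n−l−1, n−1) − C(2n−l−1, n), where C(a,b) on the right-hand side denotes the binomial coefficient. -/

import Mathlib

/-- Any function `C : ℕ × ℕ → ℤ` with boundary values `C(n,0) = 0`, `C(n,n) = 1` for `n ≥ 1`,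
satisfying the Pascal-type recursion `C(n,l) = C(n-1, l-1) + C(n, l+1)` for `n ≥ 2` and
`1 ≤ l ≤ n-1`, is given by the closed binomial formula
`C(n,l) = C(2n-l-1, n-1) - C(2n-l-1, n)` for all `n ≥ 1` and `0 ≤ l ≤ n`. -/
theorem closed_formula_of_recursion (C : ℕ × ℕ → ℤ)
    (hbd : ∀ n : ℕ, 1 ≤ n → C (n, 0) = 0 ∧ C (n, n) = 1)
    (hrec : ∀ n l : ℕ, 2 ≤ n → 1 ≤ l → l ≤ n - 1 →
      C (n, l) = C (n - 1, l - 1) + C (n, l + 1)) :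
    ∀ n l : ℕ, 1 ≤ n → l ≤ n →
      C (n, l) = ((2 * n - l - 1).choose (n - 1) : ℤ) - ((2 * n - l - 1).choose n : ℤ) := by
  have key : ∀ m d e : ℕ, d + e = m + 1 →
      C (m + 1, e) = ((m + d).choose m : ℤ) - ((m + d).choose (m + 1) : ℤ) := by
    intro m
    induction m with
    | zero =>
      intro d e h
      obtain ⟨rfl, rfl⟩ | ⟨rfl, rfl⟩ : (d = 0 ∧ e = 1) ∨ (d = 1 ∧ e = 0) := by omega
      · simpa using (hbd 1 le_rfl).2
      · simpa using (hbd 1 le_rfl).1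
    | succ m ihm =>
      intro d
      induction d with
      | zero =>
        intro e h
        obtain rfl : e = m + 1 + 1 := by omega
        simpa using (hbd (m + 1 + 1) (by omega)).2
      | succ d ihd =>
        intro e h
        cases e with
        | zero =>
          obtain rfl : d = m + 1 := by omega
          rw [(hbd (m + 1 + 1) (by omega)).1,
            Nat.choose_symm_of_eq_add (show m + 1 + (m + 1 + 1) = (m + 1) + (m + 1 + 1) from rfl),
            sub_self]
        | succ e =>
          have hr := hrec (m + 1 + 1) (e + 1) (by omega) (by omega) (by omega)
          simp only [Nat.add_sub_cancel] at hr
          rw [hr, ihm (d + 1) e (by omega), ihd (e + 1 + 1) (by omega),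
            show m + 1 + (d + 1) = (m + 1 + d) + 1 by omega,
            show m + (d + 1) = m + 1 + d by omega,
            Nat.choose_succ_succ (m + 1 + d) m, Nat.choose_succ_succ (m + 1 + d) (m + 1)]
          push_cast
          ring
  intro n l hn hl
  obtain ⟨m, rfl⟩ := Nat.exists_eq_add_of_le' hn
  rw [key m (m + 1 - l) l (by omega), show 2 * (m + 1) - l - 1 = m + (m + 1 - l) by omega,
    Nat.add_sub_cancel]
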